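/- Let N ≥ 2 be an integer, p a real with 1 < p < N, and let γ be a fixed real number with N(N−p)/(Np−(N−p)) < γ < (N−p)/(p−1). Let α_n → α > 0 and ε_n → 0 be sequences with ε_n > 0, and let u_n := u_{ε_n,α_n} be the approximate radial solutions. Then: (i) ∫_{ℝ^N} |∇u_n(x) − ∇U_α(x)|^p dx → 0 as n → ∞ (the gradients being defined almost everywhere); (ii) sup_{x∈ℝ^N} (1+|x|)^γ |u_n(x) − U_α(x)| → 0 as n → ∞. -/

import Mathlib

open MeasureTheory Real

noncomputable section

/-- The normalizing constant `C_{N,p,α}`. -/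
def Cnpa (N p α : ℝ) : ℝ :=
  ((N + α) * ((N - p) / (p - 1)) ^ (p - 1)) ^ ((N - p) / (p * (p + α)))

/-- The radial profile `U_α(r)` of the standard solution. -/
def Urad (N p α r : ℝ) : ℝ :=
  Cnpa N p α * (1 + r ^ ((p + α) / (p - 1))) ^ (-((N - p) / (p + α)))

/-- The standard solution `U_α` on `ℝ^N`. -/
def Ufun (N : ℕ) (p α : ℝ) (x : EuclideanSpace ℝ (Fin N)) : ℝ := Urad N p α ‖x‖

/-- The approximate radial solution `u_{ε,α}` on `ℝ^N`. -/
def approxSol (N : ℕ) (p α ε : ℝ) (x : EuclideanSpace ℝ (Fin N)) : ℝ :=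
  if ‖x‖ ≤ 1 / ε then Urad N p α ‖x‖ - Urad N p α (1 / ε) else 0


open Filter Topology

/-- The radial derivative of the standard solution. -/
def Urad' (N p α r : ℝ) : ℝ :=
  Cnpa N p α * ((p + α) / (p - 1) * r ^ ((p + α) / (p - 1) - 1) *
    (-((N - p) / (p + α))) * (1 + r ^ ((p + α) / (p - 1))) ^ (-((N - p) / (p + α)) - 1))

lemma hasDerivAt_Urad (N p α : ℝ) {r : ℝ} (hr : 0 < r) :
    HasDerivAt (Urad N p α) (Urad' N p α r) r := by
  have hbase : HasDerivAt (fun r : ℝ => 1 + r ^ ((p + α) / (p - 1)))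
      ((p + α) / (p - 1) * r ^ ((p + α) / (p - 1) - 1)) r :=
    (Real.hasDerivAt_rpow_const (Or.inl hr.ne')).const_add 1
  exact (hbase.rpow_const (Or.inl (by positivity))).const_mul (Cnpa N p α)

lemma Cnpa_nonneg {N p α : ℝ} (hp1 : 1 < p) (hpN : p < N) (hα : 0 < α) : 0 ≤ Cnpa N p α := by
  have h1 : 0 < p - 1 := by linarith
  have h2 : 0 < N - p := by linarith
  have h3 : 0 < N + α := by linarith
  unfold Cnpa
  positivity

lemma Urad_nonneg {N p α r : ℝ} (hp1 : 1 < p) (hpN : p < N) (hα : 0 < α) (hr : 0 ≤ r) :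
    0 ≤ Urad N p α r := by
  have := Cnpa_nonneg hp1 hpN hα
  unfold Urad
  positivity

lemma max_rpow_le_one_add_rpow {r q : ℝ} (hr : 0 ≤ r) : max 1 r ^ q ≤ 1 + r ^ q := by
  rcases le_total r 1 with h | h
  · rw [max_eq_left h, Real.one_rpow]
    linarith [Real.rpow_nonneg hr q]
  · rw [max_eq_right h]
    linarith

lemma max_rpow_neg_le {r s : ℝ} (hr : 0 ≤ r) (hs : 0 ≤ s) :
    max 1 r ^ (-s) ≤ 2 ^ s * (1 + r) ^ (-s) := by
  have h : (2 : ℝ) ^ s * (1 + r) ^ (-s) = ((1 + r) / 2) ^ (-s) := by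
    rw [Real.div_rpow (by linarith) (by norm_num), Real.rpow_neg (by norm_num : (0:ℝ) ≤ 2),
      div_inv_eq_mul, mul_comm]
  rw [h]
  exact Real.rpow_le_rpow_of_nonpos (by linarith)
    (by linarith [le_max_left 1 r, le_max_right 1 r]) (by linarith)

lemma Urad_le {N p α r : ℝ} (hp1 : 1 < p) (hpN : p < N) (hα : 0 < α) (hr : 0 ≤ r) :
    Urad N p α r ≤ Cnpa N p α * (2 ^ ((N - p) / (p - 1)) * (1 + r) ^ (-((N - p) / (p - 1)))) := by
  have h1 : 0 < p - 1 := by linarith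
  have h2 : 0 < N - p := by linarith
  have h3 : 0 < p + α := by linarith
  unfold Urad
  refine mul_le_mul_of_nonneg_left ?_ (Cnpa_nonneg hp1 hpN hα)
  refine le_trans ?_ (max_rpow_neg_le hr (by positivity))
  have hM : 0 < max 1 r := lt_max_of_lt_left one_pos
  have h4 := Real.rpow_le_rpow_of_nonpos (z := -((N - p) / (p + α))) (Real.rpow_pos_of_pos hM _)
    (max_rpow_le_one_add_rpow (q := (p + α) / (p - 1)) hr)
    (neg_nonpos.2 (by positivity))
  rw [← Real.rpow_mul hM.le] at h4
  rwa [show (p + α) / (p - 1) * -((N - p) / (p + α)) = -((N - p) / (p - 1)) by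
    field_simp] at h4

lemma abs_Urad'_le {N p α r : ℝ} (hp1 : 1 < p) (hpN : p < N) (hα : 0 < α) (hr : 0 ≤ r) :
    |Urad' N p α r| ≤ Cnpa N p α * ((N - p) / (p - 1) *
      (2 ^ ((N - p) / (p - 1) + 1) * (1 + r) ^ (-((N - p) / (p - 1) + 1)))) := by
  have h1 : 0 < p - 1 := by linarith
  have h2 : 0 < N - p := by linarith
  have h3 : 0 < p + α := by linarith
  have hM : 0 < max 1 r := lt_max_of_lt_left one_pos
  have heq : Urad' N p α r = -(Cnpa N p α * ((N - p) / (p - 1) *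
      (r ^ ((p + α) / (p - 1) - 1) *
        (1 + r ^ ((p + α) / (p - 1))) ^ (-((N - p) / (p + α)) - 1)))) := by
    unfold Urad'
    field_simp
  have hC := Cnpa_nonneg hp1 hpN hα
  rw [heq, abs_neg, abs_of_nonneg (by positivity)]
  refine mul_le_mul_of_nonneg_left (mul_le_mul_of_nonneg_left ?_ (by positivity)) hC
  refine le_trans ?_ (max_rpow_neg_le hr (by positivity))
  have h4 := Real.rpow_le_rpow_of_nonpos (z := -((N - p) / (p + α)) - 1)
    (Real.rpow_pos_of_pos hM _)
    (max_rpow_le_one_add_rpow (q := (p + α) / (p - 1)) hr)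
    (by linarith [div_pos h2 h3])
  have hq : 0 ≤ (p + α) / (p - 1) - 1 := by
    rw [sub_nonneg, one_le_div h1]; linarith
  have h5 := Real.rpow_le_rpow hr (le_max_right 1 r) hq
  refine (mul_le_mul h5 h4 (by positivity) (by positivity)).trans_eq ?_
  rw [← Real.rpow_mul hM.le, ← Real.rpow_add hM]
  congr 1
  field_simp
  ring

lemma continuousAt_Cnpa {N p α : ℝ} (hp1 : 1 < p) (hpN : p < N) (hα : 0 < α) :
    ContinuousAt (Cnpa N p) α := by
  have h1 : 0 < p - 1 := by linarith
  have h2 : 0 < N - p := by linarith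
  have h3 : 0 < N + α := by linarith
  have h4 : p * (p + α) ≠ 0 := by positivity
  unfold Cnpa
  refine ContinuousAt.rpow (by fun_prop) ?_ (Or.inl (by positivity))
  exact continuousAt_const.div (by fun_prop) h4

lemma continuousAt_Urad {N p α r : ℝ} (hp1 : 1 < p) (hpN : p < N) (hα : 0 < α) (hr : 0 ≤ r) :
    ContinuousAt (fun z : ℝ × ℝ => Urad N p z.1 z.2) (α, r) := by
  have h1 : 0 < p - 1 := by linarith
  have h3 : 0 < p + α := by linarith
  unfold Urad
  refine ContinuousAt.mul ?_ (ContinuousAt.rpow (continuousAt_const.add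
    (continuousAt_snd.rpow (by fun_prop) (Or.inr (by simp only; positivity)))) ?_
      (Or.inl (by simp only; positivity)))
  · exact ContinuousAt.comp (f := Prod.fst) (x := (α, r)) (continuousAt_Cnpa hp1 hpN hα)
      continuousAt_fst
  · exact (continuousAt_const.div (continuousAt_const.add continuousAt_fst) h3.ne').neg

lemma continuousAt_Urad' {N p α r : ℝ} (hp1 : 1 < p) (hpN : p < N) (hα : 0 < α) (hr : 0 < r) :
    ContinuousAt (fun a => Urad' N p a r) α := by
  have h3 : p + α ≠ 0 := by linarith
  have hm : ContinuousAt (fun a => -((N - p) / (p + a))) α :=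
    (continuousAt_const.div (by fun_prop) h3).neg
  have hq : ContinuousAt (fun a => (p + a) / (p - 1)) α := by fun_prop
  have hr0 : ∀ a, 1 + r ^ ((p + a) / (p - 1)) ≠ 0 := fun a => by positivity
  have hrpow {f : ℝ → ℝ} (hf : ContinuousAt f α) : ContinuousAt (fun a => r ^ f a) α :=
    continuousAt_const.rpow hf (Or.inl hr.ne')
  unfold Urad'
  exact (continuousAt_Cnpa hp1 hpN hα).mul (((hq.mul (hrpow (hq.sub continuousAt_const))).mul
    hm).mul ((continuousAt_const.add (hrpow hq)).rpow (hm.sub continuousAt_const)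
      (Or.inl (hr0 α))))

lemma hasFDerivAt_Ufun {N : ℕ} (p α : ℝ) {x : EuclideanSpace ℝ (Fin N)} (hx : x ≠ 0) :
    HasFDerivAt (Ufun N p α)
      (Urad' N p α ‖x‖ • fderiv ℝ (fun y : EuclideanSpace ℝ (Fin N) => ‖y‖) x) x := by
  have hnorm : DifferentiableAt ℝ (fun y : EuclideanSpace ℝ (Fin N) => ‖y‖) x :=
    (contDiffAt_norm ℝ (n := 1) hx).differentiableAt (by simp)
  exact (hasDerivAt_Urad N p α (norm_pos_iff.2 hx)).comp_hasFDerivAt x hnorm.hasFDerivAt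

lemma fderiv_approxSol_of_lt {N : ℕ} (p α : ℝ) {ε : ℝ} {x : EuclideanSpace ℝ (Fin N)}
    (hx : ‖x‖ < 1 / ε) : fderiv ℝ (approxSol N p α ε) x = fderiv ℝ (Ufun N p α) x := by
  have h : approxSol N p α ε =ᶠ[𝓝 x] fun y => Ufun N p α y - Urad N p α (1 / ε) := by
    filter_upwards [continuous_norm.continuousAt.eventually_lt continuousAt_const hx] with y hy
    simp only [approxSol, Ufun, if_pos hy.le]
  rw [h.fderiv_eq, fderiv_sub_const]

lemma fderiv_approxSol_of_gt {N : ℕ} (p α : ℝ) {ε : ℝ} {x : EuclideanSpace ℝ (Fin N)}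
    (hx : 1 / ε < ‖x‖) : fderiv ℝ (approxSol N p α ε) x = 0 := by
  have h : approxSol N p α ε =ᶠ[𝓝 x] fun _ => 0 := by
    filter_upwards [continuousAt_const.eventually_lt continuous_norm.continuousAt hx] with y hy
    simp only [approxSol]
    exact if_neg (not_le.2 hy)
  rw [h.fderiv_eq, fderiv_fun_const]
  rfl

lemma norm_fderiv_Ufun_le {N : ℕ} {p α : ℝ} (hp1 : 1 < p) (hpN : p < N) (hα : 0 < α)
    {x : EuclideanSpace ℝ (Fin N)} (hx : x ≠ 0) :
    ‖fderiv ℝ (Ufun N p α) x‖ ≤ Cnpa N p α * ((N - p) / (p - 1) *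
      (2 ^ ((N - p) / (p - 1) + 1) * (1 + ‖x‖) ^ (-((N - p) / (p - 1) + 1)))) := by
  rw [(hasFDerivAt_Ufun p α hx).fderiv, norm_smul, Real.norm_eq_abs]
  have hlip : ‖fderiv ℝ (fun y : EuclideanSpace ℝ (Fin N) => ‖y‖) x‖ ≤ 1 := by
    simpa using norm_fderiv_le_of_lipschitz ℝ (x₀ := x)
      (lipschitzWith_one_norm (E := EuclideanSpace ℝ (Fin N)))
  exact (mul_le_of_le_one_right (abs_nonneg _) hlip).trans
    (abs_Urad'_le hp1 hpN hα (norm_nonneg x))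

lemma norm_fderiv_approxSol_le {N : ℕ} (p α : ℝ) {ε : ℝ} {x : EuclideanSpace ℝ (Fin N)}
    (hx : ‖x‖ ≠ 1 / ε) :
    ‖fderiv ℝ (approxSol N p α ε) x‖ ≤ ‖fderiv ℝ (Ufun N p α) x‖ := by
  rcases lt_or_gt_of_ne hx with h | h
  · rw [fderiv_approxSol_of_lt p α h]
  · rw [fderiv_approxSol_of_gt p α h, norm_zero]
    exact norm_nonneg _

lemma tendsto_fderiv_approxSol {N : ℕ} {p α : ℝ} (hp1 : 1 < p) (hpN : p < N) (hα : 0 < α)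
    {a e : ℕ → ℝ} (ha : Tendsto a atTop (𝓝 α)) (he : Tendsto (fun n => 1 / e n) atTop atTop)
    {x : EuclideanSpace ℝ (Fin N)} (hx : x ≠ 0) :
    Tendsto (fun n => fderiv ℝ (approxSol N p (a n) (e n)) x) atTop
      (𝓝 (fderiv ℝ (Ufun N p α) x)) := by
  have hev : (fun n => fderiv ℝ (approxSol N p (a n) (e n)) x) =ᶠ[atTop] fun n =>
      Urad' N p (a n) ‖x‖ • fderiv ℝ (fun y : EuclideanSpace ℝ (Fin N) => ‖y‖) x := by
    filter_upwards [he.eventually_gt_atTop ‖x‖] with n hn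
    rw [fderiv_approxSol_of_lt p (a n) hn, (hasFDerivAt_Ufun p (a n) hx).fderiv]
  rw [tendsto_congr' hev, (hasFDerivAt_Ufun p α hx).fderiv]
  exact ((continuousAt_Urad' hp1 hpN hα (norm_pos_iff.2 hx)).tendsto.comp ha).smul_const _

lemma tendsto_integral_fderiv_approxSol_sub {N : ℕ} {p α : ℝ} (hN : 2 ≤ N) (hp1 : 1 < p)
    (hpN : p < N) (hα : 0 < α) {a e : ℕ → ℝ} (ha : Tendsto a atTop (𝓝 α))
    (he : Tendsto (fun n => 1 / e n) atTop atTop) :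
    Tendsto (fun n => ∫ x : EuclideanSpace ℝ (Fin N),
        ‖fderiv ℝ (approxSol N p (a n) (e n)) x - fderiv ℝ (Ufun N p α) x‖ ^ p)
      atTop (𝓝 0) := by
  have h1 : 0 < p - 1 := by linarith
  have h2 : 0 < (N : ℝ) - p := by linarith
  have hp0 : 0 < p := by linarith
  have : Nonempty (Fin N) := ⟨⟨0, by omega⟩⟩
  set β : ℝ := ((N : ℝ) - p) / (p - 1) with hβ
  have hβ0 : 0 < β := by positivity
  have hC0 := Cnpa_nonneg hp1 hpN hα
  set K : ℝ := (Cnpa N p α + 1 + Cnpa N p α) * (β * 2 ^ (β + 1)) with hK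
  have hK0 : 0 ≤ K := by positivity
  have hlim := tendsto_integral_filter_of_dominated_convergence (l := atTop) (μ := volume)
    (F := fun n (x : EuclideanSpace ℝ (Fin N)) =>
      ‖fderiv ℝ (approxSol N p (a n) (e n)) x - fderiv ℝ (Ufun N p α) x‖ ^ p)
    (f := fun _ => 0) (fun x => K ^ p * (1 + ‖x‖) ^ (-((β + 1) * p))) ?_ ?_ ?_ ?_
  · simpa using hlim
  · exact Eventually.of_forall fun n => (((measurable_fderiv ℝ _).sub
      (measurable_fderiv ℝ _)).norm.pow_const p).aestronglyMeasurable
  · filter_upwards [ha.eventually (eventually_gt_nhds hα),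
      ((continuousAt_Cnpa hp1 hpN hα).tendsto.comp ha).eventually_lt_const
        (lt_add_one (Cnpa N p α))] with n hn hCn
    have hne : ∀ᵐ x : EuclideanSpace ℝ (Fin N), x ∉ Metric.sphere 0 (1 / e n) :=
      measure_eq_zero_iff_ae_notMem.1 (Measure.addHaar_sphere volume 0 _)
    have hne0 : ∀ᵐ x : EuclideanSpace ℝ (Fin N), x ≠ 0 := Measure.ae_ne volume 0
    filter_upwards [hne, hne0] with x hx hx0
    rw [mem_sphere_zero_iff_norm] at hx
    have hw : 0 ≤ (1 + ‖x‖) ^ (-(β + 1)) := by positivity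
    rw [Real.norm_of_nonneg (by positivity), ← neg_mul, Real.rpow_mul (by positivity),
      ← Real.mul_rpow hK0 hw]
    refine Real.rpow_le_rpow (norm_nonneg _) ((norm_sub_le _ _).trans ?_) hp0.le
    have b1 := (norm_fderiv_approxSol_le p (a n) hx).trans (norm_fderiv_Ufun_le hp1 hpN hn hx0)
    have b2 := norm_fderiv_Ufun_le hp1 hpN hα hx0
    rw [← hβ] at b1 b2
    have b3 := mul_le_mul_of_nonneg_right hCn.le
      (show 0 ≤ β * (2 ^ (β + 1) * (1 + ‖x‖) ^ (-(β + 1))) by positivity)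
    simp only [Function.comp_apply] at b3
    refine (add_le_add (b1.trans b3) b2).trans_eq ?_
    rw [hK]
    ring
  · refine (integrable_one_add_norm ?_).const_mul _
    rw [finrank_euclideanSpace_fin, hβ, div_add_one h1.ne', div_mul_eq_mul_div, lt_div_iff₀ h1]
    nlinarith
  · have hne0 : ∀ᵐ x : EuclideanSpace ℝ (Fin N), x ≠ 0 := Measure.ae_ne volume 0
    filter_upwards [hne0] with x hx0
    have h := ((tendsto_fderiv_approxSol hp1 hpN hα ha he hx0).sub_const
      (fderiv ℝ (Ufun N p α) x)).norm.rpow_const (p := p) (Or.inr hp0.le)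
    simpa [hp0.ne'] using h

lemma eventually_weighted_sub_lt {N : ℕ} {p γ α : ℝ} (hp1 : 1 < p) (hpN : p < N) (hγ0 : 0 ≤ γ)
    (hγ : γ < ((N : ℝ) - p) / (p - 1)) (hα : 0 < α) {a e : ℕ → ℝ} (ha : Tendsto a atTop (𝓝 α))
    (he : Tendsto (fun n => 1 / e n) atTop atTop) {δ : ℝ} (hδ : 0 < δ) :
    ∀ᶠ n in atTop, ∀ x : EuclideanSpace ℝ (Fin N),
      (1 + ‖x‖) ^ γ * |approxSol N p (a n) (e n) x - Ufun N p α x| < δ := by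
  set β : ℝ := ((N : ℝ) - p) / (p - 1) with hβ
  have hβ0 : 0 < β := by linarith
  have hC0 := Cnpa_nonneg hp1 hpN hα
  set K : ℝ := (Cnpa N p α + 1) * 2 ^ β with hK
  have hK0 : 0 ≤ K := by positivity
  have htail : Tendsto (fun r : ℝ => K * (1 + r) ^ (γ - β)) atTop (𝓝 0) := by
    have h := (tendsto_rpow_neg_atTop (y := β - γ) (by linarith)).comp
      (tendsto_atTop_add_const_left atTop (1 : ℝ) tendsto_id)
    simpa [Function.comp_def] using h.const_mul K
  have hdecay : ∀ {b r : ℝ}, 0 < b → Cnpa N p b ≤ Cnpa N p α + 1 → 0 ≤ r →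
      (1 + r) ^ γ * Urad N p b r ≤ K * (1 + r) ^ (γ - β) := by
    intro b r hb hCb hr
    have hw : 0 ≤ (2 : ℝ) ^ β * (1 + r) ^ (-β) := by positivity
    calc (1 + r) ^ γ * Urad N p b r
        ≤ (1 + r) ^ γ * ((Cnpa N p α + 1) * (2 ^ β * (1 + r) ^ (-β))) :=
          mul_le_mul_of_nonneg_left ((Urad_le hp1 hpN hb hr).trans
            (mul_le_mul_of_nonneg_right hCb hw)) (by positivity)
      _ = K * (1 + r) ^ (γ - β) := by
          rw [sub_eq_add_neg, Real.rpow_add (by positivity), hK]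
          ring
  obtain ⟨R, hR, hR0⟩ := ((htail.eventually_lt_const
    (show (0 : ℝ) < δ / 4 by positivity)).and (eventually_ge_atTop 0)).exists
  have hmono : ∀ {r : ℝ}, R ≤ r → K * (1 + r) ^ (γ - β) < δ / 4 := fun hr =>
    (mul_le_mul_of_nonneg_left (Real.rpow_le_rpow_of_nonpos (by linarith) (by linarith)
      (by linarith)) hK0).trans_lt hR
  have hpos : 0 < δ / 4 / (1 + R) ^ γ := by positivity
  have hunif : ∀ᶠ b in 𝓝 α, ∀ r ∈ Set.Icc 0 R,
      |Urad N p b r - Urad N p α r| < δ / 4 / (1 + R) ^ γ := by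
    have hcont : ContinuousOn (Function.uncurry (Urad N p)) (Set.Ioi 0 ×ˢ Set.Icc 0 R) :=
      fun z hz => (continuousAt_Urad hp1 hpN hz.1 hz.2.1).continuousWithinAt
    obtain ⟨v, hv, hvu⟩ := isCompact_Icc.mem_uniformity_of_prod hcont
      (show α ∈ Set.Ioi 0 from hα) (Metric.dist_mem_uniformity hpos)
    rw [(isOpen_Ioi).nhdsWithin_eq (show α ∈ Set.Ioi 0 from hα)] at hv
    filter_upwards [hv] with b hb r hr
    simpa [Real.dist_eq] using hvu b hb r hr
  filter_upwards [ha.eventually hunif, ha.eventually (eventually_gt_nhds hα),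
    ((continuousAt_Cnpa hp1 hpN hα).tendsto.comp ha).eventually_lt_const
      (lt_add_one (Cnpa N p α)), he.eventually_ge_atTop R] with n hun hn hCn hRn x
  have hr := norm_nonneg x
  have hw : 0 < (1 + ‖x‖) ^ γ := by positivity
  have hU := Urad_nonneg hp1 hpN hα hr
  have hUd := hdecay hα (by linarith) hr
  have hUn := Urad_nonneg hp1 hpN hn hr
  have hUnd := hdecay hn hCn.le hr
  have hdiff : (1 + ‖x‖) ^ γ * |Urad N p (a n) ‖x‖ - Urad N p α ‖x‖| < δ / 2 := by
    rcases le_total ‖x‖ R with h | h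
    · have h1 : (1 + ‖x‖) ^ γ ≤ (1 + R) ^ γ :=
        Real.rpow_le_rpow (by positivity) (by linarith) hγ0
      have h2 := (lt_div_iff₀' (by positivity)).1 (hun _ ⟨hr, h⟩)
      linarith [mul_le_mul_of_nonneg_right h1 (abs_nonneg (Urad N p (a n) ‖x‖ - Urad N p α ‖x‖))]
    · have h1 : |Urad N p (a n) ‖x‖ - Urad N p α ‖x‖| ≤ Urad N p (a n) ‖x‖ + Urad N p α ‖x‖ :=
        abs_le.2 ⟨by linarith, by linarith⟩
      have h2 := mul_le_mul_of_nonneg_left h1 hw.le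
      linarith [hmono h]
  unfold approxSol Ufun
  split_ifs with h
  · have he0 : 0 ≤ 1 / e n := hR0.trans hRn
    have h0 := Urad_nonneg hp1 hpN hn he0
    have h1 : |Urad N p (a n) ‖x‖ - Urad N p (a n) (1 / e n) - Urad N p α ‖x‖| ≤
        |Urad N p (a n) ‖x‖ - Urad N p α ‖x‖| + Urad N p (a n) (1 / e n) := by
      rw [sub_right_comm]
      exact (abs_sub _ _).trans_eq (by rw [abs_of_nonneg h0])
    have h2 := mul_le_mul_of_nonneg_left h1 hw.le
    have h3 : (1 + ‖x‖) ^ γ * Urad N p (a n) (1 / e n) ≤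
        (1 + 1 / e n) ^ γ * Urad N p (a n) (1 / e n) :=
      mul_le_mul_of_nonneg_right (Real.rpow_le_rpow (by positivity) (by linarith) hγ0) h0
    linarith [hmono hRn, hdecay hn hCn.le he0]
  · rw [zero_sub, abs_neg, abs_of_nonneg hU]
    linarith [hmono (hRn.trans (not_le.1 h).le)]

/-- If `α_n → α > 0` and `ε_n → 0` (`ε_n > 0`), then the approximate
radial solutions `u_n := u_{ε_n,α_n}` satisfy
(i) `∫_{ℝ^N} |∇u_n - ∇U_α|^p dx → 0`, and
(ii) `sup_x (1+|x|)^γ |u_n(x) - U_α(x)| → 0`,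
for any fixed `γ` with `N(N-p)/(Np-(N-p)) < γ < (N-p)/(p-1)`. -/
theorem stmt_8 (N : ℕ) (hN : 2 ≤ N) (p : ℝ) (hp1 : 1 < p) (hpN : p < N)
    (γ : ℝ) (hγ1 : (N : ℝ) * ((N : ℝ) - p) / ((N : ℝ) * p - ((N : ℝ) - p)) < γ)
    (hγ2 : γ < ((N : ℝ) - p) / (p - 1))
    (α : ℝ) (hα : 0 < α) (a e : ℕ → ℝ)
    (ha : Filter.Tendsto a Filter.atTop (nhds α))
    (he : Filter.Tendsto e Filter.atTop (nhds 0)) (hepos : ∀ n, 0 < e n) :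
    Filter.Tendsto (fun n => ∫ x : EuclideanSpace ℝ (Fin N),
        ‖fderiv ℝ (approxSol N p (a n) (e n)) x - fderiv ℝ (Ufun N p α) x‖ ^ p)
      Filter.atTop (nhds 0) ∧
    ∀ δ : ℝ, 0 < δ → ∃ n₀ : ℕ, ∀ n, n₀ ≤ n → ∀ x : EuclideanSpace ℝ (Fin N),
      (1 + ‖x‖) ^ γ * |approxSol N p (a n) (e n) x - Ufun N p α x| < δ := by
  have he' : Tendsto (fun n => 1 / e n) atTop atTop := by
    simp only [one_div]
    exact (tendsto_nhdsWithin_iff.2 ⟨he, Eventually.of_forall hepos⟩).inv_tendsto_nhdsGT_zero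
  have hγ0 : 0 ≤ γ := by
    have hden : 0 ≤ (N : ℝ) * p - ((N : ℝ) - p) := by nlinarith
    have hnum : 0 ≤ (N : ℝ) * ((N : ℝ) - p) := mul_nonneg N.cast_nonneg (by linarith)
    exact (div_nonneg hnum hden).trans hγ1.le
  refine ⟨tendsto_integral_fderiv_approxSol_sub hN hp1 hpN hα ha he', fun δ hδ => ?_⟩
  exact eventually_atTop.1 (eventually_weighted_sub_lt hp1 hpN hγ0 hγ2 hα ha he' hδ)
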